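/- arXiv:1405.4069 — 3 statements merged into one kernel-verified Lean document; each statement's English description precedes it below -/
import Mathlib

section
/- Let q : [0,T] → ℝⁿ be continuous with q(t) ≠ 0 for all t, and for i = 1,…,n define G_i(q) = ∫₀ᵀ q_i(t)‖q(t)‖ dt. Then for every continuous v : [0,T] → ℝⁿ, the Gateaux derivative of G_i at q in direction v exists and equals ∫₀ᵀ ⟨v(t), (q_i(t)/‖q(t)‖)·q(t) + ‖q(t)‖·e_i⟩ dt, i.e. the L² inner product of v with (q_i/‖q‖)q + ‖q‖e_i, where e_i is the i-th standard basis vector of ℝⁿ. Hence the normal space to the closure constraint {G_i = 0, i = 1,…,n} at q is spanned by the functions (q_i/‖q‖)q + ‖q‖e_i. -/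
open Set
open scoped RealInnerProductSpace

/-- Along a line through a point `x ≠ 0`, the map `y ↦ yᵢ‖y‖` has derivative given by the inner
product with its gradient `(xᵢ/‖x‖)x + ‖x‖eᵢ`. -/
theorem EuclideanSpace.hasDerivAt_apply_mul_norm {n : ℕ} {x : EuclideanSpace ℝ (Fin n)}
    (hx : x ≠ 0) (y : EuclideanSpace ℝ (Fin n)) (i : Fin n) :
    HasDerivAt (fun ε : ℝ => (x + ε • y) i * ‖x + ε • y‖)
      ⟪y, (x i / ‖x‖) • x + ‖x‖ • (EuclideanSpace.single i (1 : ℝ))⟫ 0 := by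
  have hline : HasDerivAt (fun ε : ℝ => x + ε • y) y 0 := by
    simpa using ((hasDerivAt_id (0 : ℝ)).smul_const y).const_add x
  have hcoord : HasDerivAt (fun ε : ℝ => (x + ε • y) i) (y i) 0 := by
    simpa using ((hasDerivAt_id (0 : ℝ)).mul_const (y i)).const_add (x i)
  have hnorm : HasDerivAt (fun ε : ℝ => ‖x + ε • y‖) (⟪x, y⟫ / ‖x‖) 0 := by
    have h := hline.norm_sq.sqrt (by simpa using hx)
    simp only [Real.sqrt_sq (norm_nonneg _), zero_smul, add_zero] at h
    convert h using 1
    rw [mul_div_mul_left _ _ two_ne_zero]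
  refine (hcoord.mul hnorm).congr_deriv ?_
  rw [inner_add_right, inner_smul_right, inner_smul_right, EuclideanSpace.inner_single_right,
    real_inner_comm, zero_smul, add_zero, conj_trivial]
  ring

/-- The map `x ↦ xᵢ‖x‖` is Lipschitz on bounded sets. -/
theorem EuclideanSpace.norm_apply_mul_norm_sub_le {n : ℕ} (x y : EuclideanSpace ℝ (Fin n))
    (i : Fin n) : ‖x i * ‖x‖ - y i * ‖y‖‖ ≤ (‖x‖ + ‖y‖) * ‖x - y‖ := by
  calc ‖x i * ‖x‖ - y i * ‖y‖‖ = ‖(x - y) i * ‖x‖ + y i * (‖x‖ - ‖y‖)‖ := by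
        congr 1
        rw [PiLp.sub_apply]
        ring
    _ ≤ ‖(x - y) i‖ * ‖x‖ + ‖y i‖ * ‖‖x‖ - ‖y‖‖ := by
        refine (norm_add_le _ _).trans_eq ?_
        rw [norm_mul, norm_mul, norm_norm]
    _ ≤ ‖x - y‖ * ‖x‖ + ‖y‖ * ‖x - y‖ := by
        gcongr
        · exact PiLp.norm_apply_le _ i
        · exact PiLp.norm_apply_le _ i
        · exact abs_norm_sub_norm_le x y
    _ = (‖x‖ + ‖y‖) * ‖x - y‖ := by ring

/-- For nonvanishing continuous `q : [0,T] → ℝⁿ`, the Gateaux derivative of the closure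
constraint functional `G_i(q) = ∫₀ᵀ q_i‖q‖ dt` at `q` in a continuous direction `v`
exists and equals `∫₀ᵀ ⟨v(t), (q_i(t)/‖q(t)‖)·q(t) + ‖q(t)‖·e_i⟩ dt`, i.e. the `L²`
inner product of `v` with the normal-space basis function `(q_i/‖q‖)q + ‖q‖e_i`. -/
theorem closure_constraint_gateaux (n : ℕ) (T : ℝ) (hT : 0 < T)
    (q v : ℝ → EuclideanSpace ℝ (Fin n)) (hq : Continuous q) (hv : Continuous v)
    (hne : ∀ t ∈ Icc (0:ℝ) T, q t ≠ 0) :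
    ∀ i : Fin n,
      HasDerivAt (fun ε : ℝ => ∫ t in (0:ℝ)..T, (q t + ε • v t) i * ‖q t + ε • v t‖)
        (∫ t in (0:ℝ)..T,
          ⟪v t, (q t i / ‖q t‖) • q t + ‖q t‖ • (EuclideanSpace.single i (1:ℝ))⟫) 0 := by
  intro i
  have hcont (ε : ℝ) : Continuous fun t => (q t + ε • v t) i * ‖q t + ε • v t‖ := by fun_prop
  have hmem {t : ℝ} (ht : t ∈ uIoc 0 T) : t ∈ Icc 0 T :=
    Ioc_subset_Icc_self (uIoc_of_le hT.le ▸ ht)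
  have hgrad : ContinuousOn (fun t =>
      ⟪v t, (q t i / ‖q t‖) • q t + ‖q t‖ • (EuclideanSpace.single i (1:ℝ))⟫) (uIoc 0 T) := by
    have hdiv : ContinuousOn (fun t => q t i / ‖q t‖) (uIoc 0 T) :=
      ContinuousOn.div (by fun_prop) (by fun_prop) fun t ht => norm_ne_zero_iff.mpr (hne t (hmem ht))
    exact hv.continuousOn.inner (𝕜 := ℝ) ((hdiv.smul hq.continuousOn).add (by fun_prop))
  refine (intervalIntegral.hasDerivAt_integral_of_dominated_loc_of_lip
    (bound := fun t => 2 * (‖q t‖ + ‖v t‖) * ‖v t‖)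
    (Metric.ball_mem_nhds (0 : ℝ) one_pos) (.of_forall fun ε => (hcont ε).aestronglyMeasurable)
    ((hcont 0).intervalIntegrable 0 T) (hgrad.aestronglyMeasurable measurableSet_uIoc)
    (.of_forall fun t _ => ?_)
    (Continuous.intervalIntegrable (by fun_prop) 0 T)
    (.of_forall fun t ht => EuclideanSpace.hasDerivAt_apply_mul_norm (hne t (hmem ht)) _ i)).2
  refine LipschitzOnWith.of_dist_le_mul fun a ha b hb => ?_
  have hbound {ε : ℝ} (hε : ε ∈ Metric.ball (0 : ℝ) 1) :
      ‖q t + ε • v t‖ ≤ ‖q t‖ + ‖v t‖ := by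
    refine (norm_add_le _ _).trans ?_
    gcongr
    rw [norm_smul]
    exact mul_le_of_le_one_left (norm_nonneg _) (mem_ball_zero_iff.mp hε).le
  rw [Real.coe_nnabs, abs_of_nonneg (by positivity), dist_eq_norm, dist_eq_norm]
  calc _ ≤ (‖q t + a • v t‖ + ‖q t + b • v t‖) * ‖(q t + a • v t) - (q t + b • v t)‖ :=
        EuclideanSpace.norm_apply_mul_norm_sub_le _ _ i
    _ ≤ ((‖q t‖ + ‖v t‖) + (‖q t‖ + ‖v t‖)) * ‖(q t + a • v t) - (q t + b • v t)‖ := by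
        gcongr
        · exact hbound ha
        · exact hbound hb
    _ = 2 * (‖q t‖ + ‖v t‖) * ‖v t‖ * ‖a - b‖ := by
        rw [add_sub_add_left_eq_sub, ← sub_smul, norm_smul]
        ring
end

section
/- Let c : [0,T] → ℝⁿ be continuously differentiable with c'(t) ≠ 0 for all t, and let h : [0,T] → ℝⁿ be continuously differentiable. Then the Gateaux derivative of the square-root velocity map R at c in direction h exists pointwise and is given by DR[c](h)(t) = (1/√‖c'(t)‖)·( h'(t) − ½⟨v(t), h'(t)⟩·v(t) ), where v(t) = c'(t)/‖c'(t)‖ is the unit tangent vector of c. -/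
open Set
open scoped RealInnerProductSpace

section InnerProductSpace

variable {E : Type*} [NormedAddCommGroup E] [InnerProductSpace ℝ E]
  {f : ℝ → E} {f' : E} {x : ℝ}

theorem HasDerivAt.norm_of_ne_zero (hf : HasDerivAt f f' x) (hx : f x ≠ 0) :
    HasDerivAt (fun y => ‖f y‖) (‖f x‖⁻¹ * ⟪f x, f'⟫) x := by
  have hpos : 0 < ‖f x‖ := norm_pos_iff.mpr hx
  have h := hf.norm_sq.sqrt (by positivity)
  simp only [Real.sqrt_sq (norm_nonneg _)] at h
  convert h using 1
  field_simp

/-- The derivative of the square-root velocity transform `f / √‖f‖` along a curve. -/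
theorem HasDerivAt.inv_sqrt_norm_smul (hf : HasDerivAt f f' x) (hx : f x ≠ 0) :
    HasDerivAt (fun y => (Real.sqrt ‖f y‖)⁻¹ • f y)
      ((Real.sqrt ‖f x‖)⁻¹ •
        (f' - (2⁻¹ * ⟪‖f x‖⁻¹ • f x, f'⟫) • ‖f x‖⁻¹ • f x)) x := by
  have hpos : 0 < ‖f x‖ := norm_pos_iff.mpr hx
  have hsqrt : 0 < Real.sqrt ‖f x‖ := Real.sqrt_pos.mpr hpos
  convert (((hf.norm_of_ne_zero hx).sqrt hpos.ne').fun_inv hsqrt.ne').fun_smul hf using 1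
  rw [smul_sub, sub_eq_add_neg, real_inner_smul_left, Real.sq_sqrt hpos.le]
  simp only [smul_smul, ← neg_smul]
  congr 2
  field_simp

end InnerProductSpace

/-- For a C¹ immersion `c` and a C¹ perturbation `h`, the Gateaux derivative of the
square-root velocity map `R[c] = c'/√‖c'‖` at `c` in direction `h` exists pointwise and
is `DR[c](h)(t) = ‖c'(t)‖^{-1/2}·(h'(t) − ½⟨v(t), h'(t)⟩·v(t))`, where `v = c'/‖c'‖`
is the unit tangent vector of `c`. -/
theorem srv_gateaux (n : ℕ) (T : ℝ) (hT : 0 < T)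
    (c h : ℝ → EuclideanSpace ℝ (Fin n))
    (hc : Differentiable ℝ c) (hc' : Continuous (deriv c))
    (hne : ∀ t ∈ Icc (0:ℝ) T, deriv c t ≠ 0)
    (hh : Differentiable ℝ h) (hh' : Continuous (deriv h))
    (v : ℝ → EuclideanSpace ℝ (Fin n)) (hv : ∀ t, v t = ‖deriv c t‖⁻¹ • deriv c t) :
    ∀ t ∈ Icc (0:ℝ) T,
      HasDerivAt
        (fun ε : ℝ =>
          (Real.sqrt ‖deriv (fun s => c s + ε • h s) t‖)⁻¹ •
            deriv (fun s => c s + ε • h s) t)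
        ((Real.sqrt ‖deriv c t‖)⁻¹ •
          (deriv h t - (2⁻¹ * ⟪v t, deriv h t⟫) • v t)) 0 := by
  intro t ht
  have hd (ε : ℝ) : deriv (fun s => c s + ε • h s) t = deriv c t + ε • deriv h t :=
    ((hc t).hasDerivAt.add ((hh t).hasDerivAt.const_smul ε)).deriv
  have hline : HasDerivAt (fun ε : ℝ => deriv c t + ε • deriv h t) (deriv h t) 0 := by
    simpa using ((hasDerivAt_id (0 : ℝ)).smul_const (deriv h t)).const_add (deriv c t)
  simp only [hd, hv]
  simpa using hline.inv_sqrt_norm_smul (by simpa using hne t ht)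
end

section
/- Let c : [0,T] → ℝⁿ be continuously differentiable with c'(t) ≠ 0 for all t, let v = c'/‖c'‖, and let h, k : [0,T] → ℝⁿ be continuously differentiable. Then the pullback of the L² inner product under R satisfies ∫₀ᵀ ⟨DR[c](h)(t), DR[c](k)(t)⟩ dt = ∫₀ᵀ (1/‖c'(t)‖)·( ⟨P_t h'(t), P_t k'(t)⟩ + ¼⟨v(t), h'(t)⟩·⟨v(t), k'(t)⟩ ) dt, where P_t is the orthogonal projection of ℝⁿ onto the orthogonal complement of v(t). Hence the pullback of the flat L² metric under R is a Sobolev-type elastic metric weighting the tangential (stretching) component by ¼ and the normal (bending) component by 1. -/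
open Set
open scoped RealInnerProductSpace

/-- For a unit vector `v`, the elastic splitting of an inner product into the part orthogonal
to `v` (weight `1`) and the part along `v` (weight `4⁻¹`). -/
theorem inner_sub_half_smul_eq_normal_add_tangential {E : Type*} [NormedAddCommGroup E]
    [InnerProductSpace ℝ E] {v : E} (hv : ‖v‖ = 1) (x y : E) :
    ⟪x - (2⁻¹ * ⟪v, x⟫) • v, y - (2⁻¹ * ⟪v, y⟫) • v⟫
      = ⟪x - ⟪x, v⟫ • v, y - ⟪y, v⟫ • v⟫ + 4⁻¹ * (⟪v, x⟫ * ⟪v, y⟫) := by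
  have hvv : ⟪v, v⟫ = 1 := by rw [real_inner_self_eq_norm_sq, hv, one_pow]
  simp only [inner_sub_left, inner_sub_right, real_inner_smul_left, real_inner_smul_right, hvv,
    real_inner_comm v x, real_inner_comm v y]
  ring

/-- The pullback of the flat `L²` metric under the square-root velocity map `R` is a
Sobolev-type elastic metric: with `v = c'/‖c'‖` the unit tangent, `P_t` the projection
orthogonal to `v(t)`, and `DR[c](h)(t) = ‖c'(t)‖^{-1/2}(h'(t) − ½⟨v(t),h'(t)⟩v(t))`,
one has `∫₀ᵀ ⟨DR[c](h), DR[c](k)⟩ dt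
  = ∫₀ᵀ ‖c'‖⁻¹·(⟨P h', P k'⟩ + ¼⟨v,h'⟩⟨v,k'⟩) dt`,
weighting the tangential (stretching) component by ¼ and the normal (bending)
component by 1. -/
theorem srv_pullback_metric (n : ℕ) (T : ℝ) (hT : 0 < T)
    (c h k : ℝ → EuclideanSpace ℝ (Fin n))
    (hc : Differentiable ℝ c) (hc' : Continuous (deriv c))
    (hne : ∀ t ∈ Icc (0:ℝ) T, deriv c t ≠ 0)
    (hh : Differentiable ℝ h) (hh' : Continuous (deriv h))
    (hk : Differentiable ℝ k) (hk' : Continuous (deriv k))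
    (v : ℝ → EuclideanSpace ℝ (Fin n)) (hv : ∀ t, v t = ‖deriv c t‖⁻¹ • deriv c t)
    (P : ℝ → EuclideanSpace ℝ (Fin n) → EuclideanSpace ℝ (Fin n))
    (hP : ∀ t x, P t x = x - ⟪x, v t⟫ • v t)
    (DRh DRk : ℝ → EuclideanSpace ℝ (Fin n))
    (hDRh : ∀ t, DRh t =
      (Real.sqrt ‖deriv c t‖)⁻¹ • (deriv h t - (2⁻¹ * ⟪v t, deriv h t⟫) • v t))
    (hDRk : ∀ t, DRk t =
      (Real.sqrt ‖deriv c t‖)⁻¹ • (deriv k t - (2⁻¹ * ⟪v t, deriv k t⟫) • v t)) :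
    (∫ t in (0:ℝ)..T, ⟪DRh t, DRk t⟫)
      = ∫ t in (0:ℝ)..T, ‖deriv c t‖⁻¹ *
          (⟪P t (deriv h t), P t (deriv k t)⟫ +
            4⁻¹ * (⟪v t, deriv h t⟫ * ⟪v t, deriv k t⟫)) := by
  refine intervalIntegral.integral_congr fun t ht => ?_
  rw [uIcc_of_le hT.le] at ht
  have hvt : ‖v t‖ = 1 := by
    rw [hv, norm_smul, norm_inv, norm_norm, inv_mul_cancel₀ (norm_ne_zero_iff.2 (hne t ht))]
  have hsqrt : (Real.sqrt ‖deriv c t‖)⁻¹ * (Real.sqrt ‖deriv c t‖)⁻¹ = ‖deriv c t‖⁻¹ := by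
    rw [← mul_inv, Real.mul_self_sqrt (norm_nonneg _)]
  simp only [hDRh, hDRk, hP]
  rw [real_inner_smul_left, real_inner_smul_right, ← mul_assoc, hsqrt,
    inner_sub_half_smul_eq_normal_add_tangential hvt]
end
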